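/- In the setting of orthogonal design with E_φ[φ(φ'Σφ)^{-1}φ'] = diag(1/η_i), we have 0 ≤ λ_i/η_i ≤ 1 for every i, and moreover 1 − λ_i/η_i ≤ w_i where w_i = [(1+1/d)λ_i² + (1+2/d)λ_i s + s²/d] / [(d+2+1/d)λ_i² + 2(1+1/d)λ_i s + s²/d] with s = trace(Σ). -/

import Mathlib

open MeasureTheory ProbabilityTheory Matrix
open scoped NNReal

theorem integrable_pow_gaussianReal (m : ℝ) (v : ℝ≥0) (k : ℕ) :
    Integrable (fun x : ℝ => x ^ k) (gaussianReal m v) := by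
  have h := (memLp_id_gaussianReal (μ := m) (v := v) k).integrable_norm_pow'
  refine (integrable_norm_iff (by fun_prop)).1 ?_
  simpa [norm_pow] using h

theorem integral_sq_gaussianReal_zero (v : ℝ≥0) :
    ∫ x, x ^ 2 ∂gaussianReal 0 v = v := by
  have h := variance_eq_sub (memLp_id_gaussianReal (μ := 0) (v := v) 2)
  simp only [variance_id_gaussianReal, Pi.pow_apply, id_eq, integral_id_gaussianReal] at h
  linarith

theorem integral_pow_four_gaussianReal_zero (v : ℝ≥0) :
    ∫ x, x ^ 4 ∂gaussianReal 0 v = 3 * (v : ℝ) ^ 2 := by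
  have h := iteratedDeriv_mgf_zero (X := id) (μ := gaussianReal 0 v)
    (by simp [integrableExpSet_id_gaussianReal]) 4
  simp only [Pi.pow_apply, id_eq] at h
  rw [← h, mgf_id_gaussianReal]
  have hexp (t : ℝ) : HasDerivAt (fun t : ℝ => Real.exp (0 * t + v * t ^ 2 / 2))
      (Real.exp (0 * t + v * t ^ 2 / 2) * (v * t)) t := by
    have h2 : HasDerivAt (fun t : ℝ => 0 * t + v * t ^ 2 / 2) (v * t) t := by
      refine ((((hasDerivAt_pow 2 t).const_mul (v : ℝ)).div_const 2).congr_deriv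
        ?_).congr_of_eventuallyEq (.of_forall fun t => ?_)
      · simp; ring
      · simp
    exact h2.exp
  have hpoly {q q' : ℝ → ℝ} (hq : ∀ t, HasDerivAt q (q' t) t) :
      deriv (fun t : ℝ => Real.exp (0 * t + v * t ^ 2 / 2) * q t)
        = fun t : ℝ => Real.exp (0 * t + v * t ^ 2 / 2) * (v * t * q t + q' t) := by
    funext t
    exact (((hexp t).mul (hq t)).congr_deriv (by ring)).deriv
  have h1 : deriv (fun t : ℝ => Real.exp (0 * t + v * t ^ 2 / 2))
      = fun t : ℝ => Real.exp (0 * t + v * t ^ 2 / 2) * (v * t) :=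
    funext fun t => (hexp t).deriv
  have hpow (c : ℝ) (k : ℕ) (t : ℝ) :
      HasDerivAt (fun t : ℝ => c * t ^ k) (c * (k * t ^ (k - 1))) t :=
    (hasDerivAt_pow k t).const_mul c
  simp only [iteratedDeriv_succ', iteratedDeriv_zero]
  rw [h1, hpoly (q' := fun _ => v) fun t => by simpa using (hasDerivAt_id t).const_mul (v : ℝ),
    hpoly (q' := fun t => 2 * (v : ℝ) ^ 2 * t) fun t => by
      refine (((hpow (v ^ 2 : ℝ) 2 t).add_const (v : ℝ)).congr_deriv
        ?_).congr_of_eventuallyEq (.of_forall fun t => ?_)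
      · norm_num; ring
      · simp only; ring,
    hpoly (q' := fun t => 3 * (v : ℝ) ^ 3 * t ^ 2 + 3 * v ^ 2) fun t => by
      refine (((hpow (v ^ 3 : ℝ) 3 t).add (hpow (3 * v ^ 2 : ℝ) 1 t)).congr_deriv
        ?_).congr_of_eventuallyEq (.of_forall fun t => ?_)
      · norm_num; ring
      · simp only [Pi.add_apply]; ring]
  simp

section Pi

variable {ι : Type*} [Fintype ι] {Ω : Type*} [MeasurableSpace Ω]

theorem integrable_pi_eval_mul_eval (ν : Measure Ω) [IsProbabilityMeasure ν] {f g : Ω → ℝ}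
    (hf : Measurable f) (hg : Measurable g) (hfi : Integrable f ν) (hgi : Integrable g ν)
    {i j : ι} (hij : i ≠ j) :
    Integrable (fun x : ι → Ω => f (x i) * g (x j)) (Measure.pi fun _ => ν) := by
  have hind : IndepFun (fun x : ι → Ω => f (x i)) (fun x => g (x j)) (Measure.pi fun _ => ν) :=
    ((iIndepFun_pi (X := fun (_ : ι) (x : Ω) => x) (μ := fun _ => ν)
      fun _ => aemeasurable_id).indepFun hij).comp hf hg
  exact hind.integrable_mul (integrable_comp_eval (μ := fun _ => ν) (i := i) (f := f) hfi)
    (integrable_comp_eval (μ := fun _ => ν) (i := j) (f := g) hgi)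

theorem integral_pi_eval_mul_eval (ν : Measure Ω) [IsProbabilityMeasure ν] {f g : Ω → ℝ}
    (hf : Measurable f) (hg : Measurable g) {i j : ι} (hij : i ≠ j) :
    ∫ x : ι → Ω, f (x i) * g (x j) ∂(Measure.pi fun _ => ν)
      = (∫ x, f x ∂ν) * ∫ x, g x ∂ν := by
  have hind : IndepFun (fun x : ι → Ω => f (x i)) (fun x => g (x j)) (Measure.pi fun _ => ν) :=
    ((iIndepFun_pi (X := fun (_ : ι) (x : Ω) => x) (μ := fun _ => ν)
      fun _ => aemeasurable_id).indepFun hij).comp hf hg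
  rw [hind.integral_fun_mul_eq_mul_integral
      (hf.comp (measurable_pi_apply i)).aestronglyMeasurable
      (hg.comp (measurable_pi_apply j)).aestronglyMeasurable,
    integral_comp_eval (μ := fun _ => ν) (i := i) hf.aestronglyMeasurable,
    integral_comp_eval (μ := fun _ => ν) (i := j) hg.aestronglyMeasurable]

end Pi

theorem pi_absolutelyContinuous {Ω : Type*} [MeasurableSpace Ω] {ν ν' : Measure Ω}
    [SigmaFinite ν] [SigmaFinite ν'] (h : ν ≪ ν') (m : ℕ) :
    (Measure.pi fun _ : Fin m => ν) ≪ Measure.pi fun _ : Fin m => ν' := by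
  induction m with
  | zero =>
    rw [Measure.pi_of_empty (fun _ => ν), Measure.pi_of_empty (fun _ => ν')]
  | succ m ih =>
    rw [← (measurePreserving_piFinSuccAbove (fun _ : Fin (m + 1) => ν) 0).symm.map_eq,
      ← (measurePreserving_piFinSuccAbove (fun _ : Fin (m + 1) => ν') 0).symm.map_eq]
    exact (h.prod ih).map (MeasurableEquiv.measurable _)

theorem ae_linearIndependent_pi {E : Type*} [NormedAddCommGroup E] [NormedSpace ℝ E]
    [FiniteDimensional ℝ E] [MeasurableSpace E] [BorelSpace E] {ν : Measure E} [SigmaFinite ν]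
    (hν : ∀ V : Submodule ℝ E, V ≠ ⊤ → ν V = 0) (m : ℕ) (hm : m ≤ Module.finrank ℝ E) :
    ∀ᵐ x ∂(Measure.pi fun _ : Fin m => ν), LinearIndependent ℝ x := by
  induction m with
  | zero => exact .of_forall fun x => linearIndependent_empty_type
  | succ m ih =>
    have hmeas : MeasurableSet {z : (Fin m → E) × E | LinearIndependent ℝ
        (Fin.cons z.2 z.1 : Fin (m + 1) → E)} := by
      have hc : Continuous fun z : (Fin m → E) × E => (Fin.cons z.2 z.1 : Fin (m + 1) → E) := by
        fun_prop
      exact (isOpen_setOfPred_linearIndependent.preimage hc).measurableSet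
    have hprod : ∀ᵐ z ∂(Measure.pi fun _ : Fin m => ν).prod ν,
        LinearIndependent ℝ (Fin.cons z.2 z.1 : Fin (m + 1) → E) := by
      rw [Measure.ae_prod_iff_ae_ae hmeas]
      filter_upwards [ih (by omega)] with x hx
      have hspan : Submodule.span ℝ (Set.range x) ≠ ⊤ := fun htop => by
        have := finrank_range_le_card (R := ℝ) x
        rw [Set.finrank, htop, finrank_top, Fintype.card_fin] at this
        omega
      filter_upwards [measure_eq_zero_iff_ae_notMem.1 (hν _ hspan)] with y hy
      exact linearIndependent_finCons.2 ⟨hx, hy⟩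
    have hmp := measurePreserving_piFinSuccAbove (fun _ : Fin (m + 1) => ν) 0
    have hmp' := Measure.measurePreserving_swap.comp hmp
    filter_upwards [hmp'.quasiMeasurePreserving.ae hprod] with x hx
    convert hx using 1
    exact (Fin.cons_self_tail x).symm

section Moments

variable {ι κ : Type*} [Fintype ι] [Fintype κ]

theorem integrable_mul_pi_gaussianReal (v : ℝ≥0) (a b : ι) :
    Integrable (fun x : ι → ℝ => x a * x b) (Measure.pi fun _ => gaussianReal 0 v) := by
  have h1 : Integrable (fun x : ℝ => x) (gaussianReal 0 v) := by
    simpa using integrable_pow_gaussianReal 0 v 1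
  by_cases hab : a = b
  · subst hab
    simpa only [sq] using integrable_comp_eval (μ := fun _ : ι => gaussianReal 0 v) (i := a)
      (integrable_pow_gaussianReal 0 v 2)
  · exact integrable_pi_eval_mul_eval _ measurable_id measurable_id h1 h1 hab

theorem integrable_sq_mul_sq_pi_gaussianReal (v : ℝ≥0) (a b : ι) :
    Integrable (fun x : ι → ℝ => x a ^ 2 * x b ^ 2) (Measure.pi fun _ => gaussianReal 0 v) := by
  by_cases hab : a = b
  · subst hab
    simpa only [← pow_add] using integrable_comp_eval (μ := fun _ : ι => gaussianReal 0 v) (i := a)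
      (integrable_pow_gaussianReal 0 v 4)
  · exact integrable_pi_eval_mul_eval _ (f := fun x => x ^ 2) (g := fun x => x ^ 2) (by fun_prop)
      (by fun_prop) (integrable_pow_gaussianReal 0 v 2) (integrable_pow_gaussianReal 0 v 2) hab

theorem integral_mul_pi_gaussianReal [DecidableEq ι] (v : ℝ≥0) (a b : ι) :
    ∫ x : ι → ℝ, x a * x b ∂(Measure.pi fun _ => gaussianReal 0 v)
      = if a = b then (v : ℝ) else 0 := by
  split_ifs with hab
  · subst hab
    simp only [← sq]
    rw [integral_comp_eval (μ := fun _ : ι => gaussianReal 0 v) (i := a) (f := fun x => x ^ 2)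
      (by fun_prop), integral_sq_gaussianReal_zero]
  · rw [integral_pi_eval_mul_eval _ (f := fun x => x) (g := fun x => x) measurable_id
      measurable_id hab]
    simp

theorem integral_sq_mul_sq_pi_gaussianReal [DecidableEq ι] (v : ℝ≥0) (a b : ι) :
    ∫ x : ι → ℝ, x a ^ 2 * x b ^ 2 ∂(Measure.pi fun _ => gaussianReal 0 v)
      = (v : ℝ) ^ 2 + if a = b then 2 * (v : ℝ) ^ 2 else 0 := by
  split_ifs with hab
  · subst hab
    simp only [← pow_add]
    rw [integral_comp_eval (μ := fun _ : ι => gaussianReal 0 v) (i := a)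
      (f := fun x => x ^ (2 + 2)) (by fun_prop), integral_pow_four_gaussianReal_zero]
    ring
  · rw [integral_pi_eval_mul_eval _ (f := fun x => x ^ 2) (g := fun x => x ^ 2) (by fun_prop)
      (by fun_prop) hab, integral_sq_gaussianReal_zero]
    ring

theorem integrable_dotProduct_self_pi_gaussianReal (v : ℝ≥0) :
    Integrable (fun x : ι → ℝ => x ⬝ᵥ x) (Measure.pi fun _ => gaussianReal 0 v) :=
  integrable_finsetSum _ fun a _ => integrable_mul_pi_gaussianReal v a a

theorem integral_dotProduct_self_pi_gaussianReal (v : ℝ≥0) :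
    ∫ x : ι → ℝ, x ⬝ᵥ x ∂(Measure.pi fun _ => gaussianReal 0 v) = Fintype.card ι * (v : ℝ) := by
  classical
  simp only [dotProduct]
  rw [integral_finsetSum _ fun a _ => integrable_mul_pi_gaussianReal v a a]
  simp [integral_mul_pi_gaussianReal]

theorem dotProduct_sq (x y : ι → ℝ) :
    (x ⬝ᵥ y) ^ 2 = ∑ a, ∑ b, (x a * x b) * (y a * y b) := by
  rw [sq, dotProduct, Finset.sum_mul_sum]
  exact Finset.sum_congr rfl fun a _ => Finset.sum_congr rfl fun b _ => by ring

theorem dotProduct_self_sq (x : ι → ℝ) :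
    (x ⬝ᵥ x) ^ 2 = ∑ a, ∑ b, x a ^ 2 * x b ^ 2 := by
  rw [dotProduct_sq]
  exact Finset.sum_congr rfl fun a _ => Finset.sum_congr rfl fun b _ => by ring

theorem integrable_dotProduct_sq_pi_pi_gaussianReal (v : ℝ≥0) (k i : κ) :
    Integrable (fun φ : κ → ι → ℝ => (φ k ⬝ᵥ φ i) ^ 2)
      (Measure.pi fun _ => Measure.pi fun _ => gaussianReal 0 v) := by
  by_cases hki : k = i
  · subst hki
    refine integrable_comp_eval (μ := fun _ : κ => Measure.pi fun _ : ι => gaussianReal 0 v)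
      (i := k) (f := fun x => (x ⬝ᵥ x) ^ 2) ?_
    simp only [dotProduct_self_sq]
    exact integrable_finsetSum _ fun a _ => integrable_finsetSum _ fun b _ =>
      integrable_sq_mul_sq_pi_gaussianReal v a b
  · simp only [dotProduct_sq]
    exact integrable_finsetSum _ fun a _ => integrable_finsetSum _ fun b _ =>
      integrable_pi_eval_mul_eval _ (f := fun x : ι → ℝ => x a * x b)
        (g := fun x : ι → ℝ => x a * x b) (by fun_prop) (by fun_prop)
        (integrable_mul_pi_gaussianReal v a b)
        (integrable_mul_pi_gaussianReal v a b) hki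

theorem integral_dotProduct_sq_pi_pi_gaussianReal [DecidableEq κ] (v : ℝ≥0) (k i : κ) :
    ∫ φ : κ → ι → ℝ, (φ k ⬝ᵥ φ i) ^ 2
        ∂(Measure.pi fun _ => Measure.pi fun _ => gaussianReal 0 v)
      = Fintype.card ι * (v : ℝ) ^ 2
        + if k = i then Fintype.card ι * (Fintype.card ι + 1) * (v : ℝ) ^ 2 else 0 := by
  classical
  split_ifs with hki
  · subst hki
    rw [integral_comp_eval (μ := fun _ : κ => Measure.pi fun _ : ι => gaussianReal 0 v)
      (i := k) (f := fun x => (x ⬝ᵥ x) ^ 2)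
      (by simp only [dotProduct]; exact Measurable.aestronglyMeasurable (by fun_prop))]
    simp only [dotProduct_self_sq]
    rw [integral_finsetSum _ fun a _ => integrable_finsetSum _ fun b _ =>
      integrable_sq_mul_sq_pi_gaussianReal v a b]
    simp only [integral_finsetSum _ fun b _ => integrable_sq_mul_sq_pi_gaussianReal v _ b,
      integral_sq_mul_sq_pi_gaussianReal, Finset.sum_add_distrib]
    simp
    ring
  · simp only [dotProduct_sq]
    have hint (a b : ι) := integrable_pi_eval_mul_eval (ι := κ)
      (Measure.pi fun _ : ι => gaussianReal 0 v) (f := fun x : ι → ℝ => x a * x b)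
      (g := fun x => x a * x b)
        (by fun_prop) (by fun_prop) (integrable_mul_pi_gaussianReal v a b)
        (integrable_mul_pi_gaussianReal v a b) hki
    have hval (a b : ι) := integral_pi_eval_mul_eval (ι := κ)
      (Measure.pi fun _ : ι => gaussianReal 0 v) (f := fun x : ι → ℝ => x a * x b)
      (g := fun x => x a * x b) (by fun_prop) (by fun_prop) hki
    rw [integral_finsetSum _ fun a _ => integrable_finsetSum _ fun b _ => hint a b]
    simp only [integral_finsetSum _ fun b _ => hint _ b, hval, integral_mul_pi_gaussianReal]
    simp [← sq]

end Moments

section Compression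

theorem isHermitian_compressed {ι κ : Type*} [Fintype κ] [DecidableEq κ]
    (Φ : Matrix κ ι ℝ) (lam : κ → ℝ) :
    (Φᵀ * diagonal lam * Φ).IsHermitian := by
  simp [IsHermitian, conjTranspose_eq_transpose_of_trivial, Matrix.mul_assoc]

theorem compressed_diag_eq {ι κ : Type*} [Fintype ι] (Φ : Matrix κ ι ℝ)
    (A : Matrix ι ι ℝ) (i : κ) :
    (Φ * A * Φᵀ) i i = Φ i ⬝ᵥ A *ᵥ Φ i := by
  rw [Matrix.mul_assoc]
  rfl

variable {ι κ : Type*} [Fintype ι] [Fintype κ] [DecidableEq κ]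

theorem dotProduct_compressed_mulVec (Φ : Matrix κ ι ℝ) (lam : κ → ℝ) (u : ι → ℝ) :
    u ⬝ᵥ (Φᵀ * diagonal lam * Φ) *ᵥ u = ∑ k, lam k * (Φ k ⬝ᵥ u) ^ 2 := by
  rw [Matrix.mul_assoc, ← mulVec_mulVec, ← mulVec_mulVec, dotProduct_mulVec, vecMul_transpose]
  simp only [mulVec_diagonal, dotProduct]
  refine Finset.sum_congr rfl fun k _ => ?_
  change (Φ k ⬝ᵥ u) * (lam k * (Φ k ⬝ᵥ u)) = lam k * (Φ k ⬝ᵥ u) ^ 2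
  ring

theorem posDef_compressed [DecidableEq ι] {Φ : Matrix κ ι ℝ} {lam : κ → ℝ}
    (hlam : ∀ k, 0 ≤ lam k) {f : ι → κ} (hf : ∀ j, lam (f j) ≠ 0)
    (hli : LinearIndependent ℝ fun j => Φ (f j)) :
    (Φᵀ * diagonal lam * Φ).PosDef := by
  refine PosDef.of_dotProduct_mulVec_pos (isHermitian_compressed Φ lam) fun u hu => ?_
  rw [star_trivial, dotProduct_compressed_mulVec]
  have hnn : ∀ k ∈ Finset.univ, 0 ≤ lam k * (Φ k ⬝ᵥ u) ^ 2 :=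
    fun k _ => mul_nonneg (hlam k) (sq_nonneg _)
  refine (Finset.sum_nonneg hnn).lt_of_ne' fun h0 => hu ?_
  have hz (j : ι) : Φ (f j) ⬝ᵥ u = 0 := by
    simpa [hf j] using (Finset.sum_eq_zero_iff_of_nonneg hnn).1 h0 (f j) (Finset.mem_univ _)
  have hunit : IsUnit (Matrix.of fun j => Φ (f j)) := linearIndependent_rows_iff_isUnit.1 hli
  exact mulVec_injective_of_isUnit hunit (by rw [mulVec_zero]; exact funext hz)

variable [DecidableEq ι] {Φ : Matrix κ ι ℝ} {lam : κ → ℝ}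

theorem compressed_diag_mem_Icc (hlam : ∀ k, 0 ≤ lam k) (hA : (Φᵀ * diagonal lam * Φ).PosDef)
    (i : κ) :
    0 ≤ (Φ * (Φᵀ * diagonal lam * Φ)⁻¹ * Φᵀ) i i ∧
      lam i * (Φ * (Φᵀ * diagonal lam * Φ)⁻¹ * Φᵀ) i i ≤ 1 := by
  rw [compressed_diag_eq]
  set A := Φᵀ * diagonal lam * Φ with hAdef
  set y := A⁻¹ *ᵥ Φ i with hy
  have hAy : A *ᵥ y = Φ i := by
    rw [hy, mulVec_mulVec, mul_nonsing_inv _ ((isUnit_iff_isUnit_det _).1 hA.isUnit), one_mulVec]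
  have hquad : Φ i ⬝ᵥ y = ∑ k, lam k * (Φ k ⬝ᵥ y) ^ 2 := by
    rw [← dotProduct_compressed_mulVec, ← hAdef, hAy, dotProduct_comm]
  have hnn : ∀ k ∈ Finset.univ, 0 ≤ lam k * (Φ k ⬝ᵥ y) ^ 2 :=
    fun k _ => mul_nonneg (hlam k) (sq_nonneg _)
  have h0 : 0 ≤ Φ i ⬝ᵥ y := hquad ▸ Finset.sum_nonneg hnn
  have h1 : lam i * (Φ i ⬝ᵥ y) ^ 2 ≤ Φ i ⬝ᵥ y :=
    (Finset.single_le_sum hnn (Finset.mem_univ i)).trans_eq hquad.symm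
  refine ⟨h0, ?_⟩
  rcases h0.eq_or_lt with h | h
  · rw [← h]; simp
  · nlinarith

theorem le_compressed_diag (hlam : ∀ k, 0 ≤ lam k) (hA : (Φᵀ * diagonal lam * Φ).PosDef)
    (i : κ) (t : ℝ) :
    2 * t * (Φ i ⬝ᵥ Φ i) - t ^ 2 * ∑ k, lam k * (Φ k ⬝ᵥ Φ i) ^ 2
      ≤ (Φ * (Φᵀ * diagonal lam * Φ)⁻¹ * Φᵀ) i i := by
  rw [compressed_diag_eq, ← dotProduct_compressed_mulVec]
  have hnn (u : ι → ℝ) : 0 ≤ u ⬝ᵥ (Φᵀ * diagonal lam * Φ) *ᵥ u := by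
    rw [dotProduct_compressed_mulVec]
    exact Finset.sum_nonneg fun k _ => mul_nonneg (hlam k) (sq_nonneg _)
  have hsymm : (Φᵀ * diagonal lam * Φ)ᵀ = Φᵀ * diagonal lam * Φ := by
    simp [Matrix.mul_assoc]
  set A := Φᵀ * diagonal lam * Φ with hAdef
  set y := A⁻¹ *ᵥ Φ i with hy
  have hAy : A *ᵥ y = Φ i := by
    rw [hy, mulVec_mulVec, mul_nonsing_inv _ ((isUnit_iff_isUnit_det _).1 hA.isUnit), one_mulVec]
  have hyA : y ⬝ᵥ A *ᵥ Φ i = Φ i ⬝ᵥ Φ i := by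
    rw [dotProduct_mulVec, ← mulVec_transpose, hsymm, hAy]
  have h := hnn (y - t • Φ i)
  simp only [mulVec_sub, mulVec_smul, hAy, sub_dotProduct, dotProduct_sub, smul_dotProduct,
    dotProduct_smul, smul_eq_mul, hyA, dotProduct_comm y] at h
  linarith

end Compression

theorem measurable_compressed_diag {p d : ℕ} (lam : Fin p → ℝ) (i : Fin p) :
    Measurable fun φ : Fin p → Fin d → ℝ =>
      (Matrix.of φ * ((Matrix.of φ)ᵀ * diagonal lam * Matrix.of φ)⁻¹ * (Matrix.of φ)ᵀ) i i := by
  have hof : Continuous fun φ : Fin p → Fin d → ℝ => Matrix.of φ := continuous_id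
  have hA : Continuous fun φ : Fin p → Fin d → ℝ =>
      (Matrix.of φ)ᵀ * diagonal lam * Matrix.of φ :=
    (hof.matrix_transpose.matrix_mul continuous_const).matrix_mul hof
  simp only [inv_def, Ring.inverse_eq_inv', Matrix.mul_smul, Matrix.smul_mul, Matrix.smul_apply,
    smul_eq_mul]
  exact hA.matrix_det.measurable.inv.mul
    (((hof.matrix_mul hA.matrix_adjugate).matrix_mul hof.matrix_transpose).matrix_elem i i).measurable

theorem pi_gaussianReal_submodule {d : ℕ} {v : ℝ≥0} (hv : v ≠ 0) (V : Submodule ℝ (Fin d → ℝ))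
    (hV : V ≠ ⊤) : (Measure.pi fun _ : Fin d => gaussianReal 0 v) V = 0 :=
  pi_absolutelyContinuous (gaussianReal_absolutelyContinuous 0 hv) d
    (Measure.addHaar_submodule volume V hV)

theorem ae_posDef_compressed {p d : ℕ} {v : ℝ≥0} (hv : v ≠ 0) {lam : Fin p → ℝ}
    (hlam : ∀ k, 0 ≤ lam k) (hcard : d ≤ Fintype.card {k // lam k ≠ 0}) :
    ∀ᵐ φ ∂(Measure.pi fun _ : Fin p => Measure.pi fun _ : Fin d => gaussianReal 0 v),
      ((Matrix.of φ)ᵀ * diagonal lam * Matrix.of φ).PosDef := by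
  obtain ⟨f⟩ := Function.Embedding.nonempty_of_card_le
    (α := Fin d) (β := {k // lam k ≠ 0}) (by simpa using hcard)
  set ν := Measure.pi fun _ : Fin d => gaussianReal 0 v with hν
  have hinj : Function.Injective fun j => (f j : Fin p) := Subtype.val_injective.comp f.injective
  have hind := (iIndepFun_pi (X := fun (_ : Fin p) (x : Fin d → ℝ) => x) (μ := fun _ => ν)
    fun _ => aemeasurable_id).precomp hinj
  have hmap := (iIndepFun_iff_map_fun_eq_pi_map fun j =>
    (measurable_pi_apply _).aemeasurable).1 hind
  have hev (k : Fin p) : Measure.map (fun φ : Fin p → Fin d → ℝ => φ k)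
      (Measure.pi fun _ => ν) = ν := (measurePreserving_eval (fun _ : Fin p => ν) k).map_eq
  simp only [hev] at hmap
  have hae := ae_linearIndependent_pi (pi_gaussianReal_submodule (d := d) hv) d (by simp)
  rw [← hν, ← hmap] at hae
  filter_upwards [ae_of_ae_map (Measurable.aemeasurable (by fun_prop)) hae] with φ hφ
  exact posDef_compressed hlam (fun j => (f j).2) hφ

theorem integral_compressed_diag_bounds {p d : ℕ} (hd : 0 < d) {lam : Fin p → ℝ}
    (hlam : ∀ k, 0 ≤ lam k) (hcard : d ≤ Fintype.card {k // lam k ≠ 0}) (i : Fin p)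
    (hi : 0 < lam i) :
    let m := ∫ φ, (Matrix.of φ * ((Matrix.of φ)ᵀ * diagonal lam * Matrix.of φ)⁻¹
        * (Matrix.of φ)ᵀ) i i ∂(Measure.pi fun _ : Fin p => Measure.pi fun _ : Fin d =>
      gaussianReal 0 ((d : ℝ≥0))⁻¹)
    0 ≤ m ∧ lam i * m ≤ 1 ∧ ((1 + 1 / (d : ℝ)) * lam i + (∑ k, lam k) / d)⁻¹ ≤ m := by
  intro m
  have hdR : (0 : ℝ) < d := by exact_mod_cast hd
  have hv : ((d : ℝ≥0))⁻¹ ≠ 0 := by positivity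
  have hvR : ((((d : ℝ≥0))⁻¹ : ℝ≥0) : ℝ) = (d : ℝ)⁻¹ := by simp
  have hae := ae_posDef_compressed hv hlam hcard
  set P := Measure.pi fun _ : Fin p => Measure.pi fun _ : Fin d =>
    gaussianReal 0 ((d : ℝ≥0))⁻¹ with hP
  have hbound := hae.mono fun φ hφ => compressed_diag_mem_Icc hlam hφ i
  have hint : Integrable (fun φ : Fin p → Fin d → ℝ => (Matrix.of φ *
      ((Matrix.of φ)ᵀ * diagonal lam * Matrix.of φ)⁻¹ * (Matrix.of φ)ᵀ) i i) P := by
    refine .of_bound (measurable_compressed_diag lam i).aestronglyMeasurable (lam i)⁻¹ ?_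
    filter_upwards [hbound] with φ hφ
    rw [Real.norm_of_nonneg hφ.1, inv_eq_one_div (lam i), le_div_iff₀' hi]
    exact hφ.2
  refine ⟨integral_nonneg_of_ae (hbound.mono fun φ hφ => hφ.1), ?_, ?_⟩
  · rw [← integral_const_mul]
    refine (integral_mono_ae (hint.const_mul _) (integrable_const 1)
      (hbound.mono fun φ hφ => hφ.2)).trans_eq (by simp)
  · have hs : 0 ≤ ∑ k, lam k := Finset.sum_nonneg fun k _ => hlam k
    set B := (1 + 1 / (d : ℝ)) * lam i + (∑ k, lam k) / d with hB
    have hBpos : 0 < B := by positivity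
    have hint1 : Integrable (fun φ : Fin p → Fin d → ℝ => φ i ⬝ᵥ φ i) P :=
      integrable_comp_eval (μ := fun _ : Fin p => Measure.pi fun _ : Fin d =>
        gaussianReal 0 ((d : ℝ≥0))⁻¹) (i := i) (f := fun x => x ⬝ᵥ x)
        (integrable_dotProduct_self_pi_gaussianReal _)
    have hE1 : ∫ φ, φ i ⬝ᵥ φ i ∂P = 1 := by
      rw [hP, integral_comp_eval (μ := fun _ : Fin p => Measure.pi fun _ : Fin d =>
        gaussianReal 0 ((d : ℝ≥0))⁻¹) (i := i) (f := fun x => x ⬝ᵥ x)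
        (integrable_dotProduct_self_pi_gaussianReal _).aestronglyMeasurable,
        integral_dotProduct_self_pi_gaussianReal, hvR, Fintype.card_fin, mul_inv_cancel₀ hdR.ne']
    have hint2 (k : Fin p) : Integrable (fun φ : Fin p → Fin d → ℝ =>
        lam k * (φ k ⬝ᵥ φ i) ^ 2) P :=
      (integrable_dotProduct_sq_pi_pi_gaussianReal _ k i).const_mul _
    have hE2 : ∫ φ, ∑ k, lam k * (φ k ⬝ᵥ φ i) ^ 2 ∂P = B := by
      rw [integral_finsetSum _ fun k _ => hint2 k]
      simp only [integral_const_mul, hP, integral_dotProduct_sq_pi_pi_gaussianReal, hvR, mul_add,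
        Finset.sum_add_distrib, ← Finset.sum_mul, Fintype.card_fin]
      simp only [mul_ite, mul_zero, Finset.sum_ite_eq', Finset.mem_univ, if_true, hB]
      field_simp
      ring
    have hint3 := (hint1.const_mul (2 * B⁻¹)).sub
      ((integrable_finsetSum Finset.univ fun k _ => hint2 k).const_mul (B⁻¹ ^ 2))
    have hle := integral_mono_ae hint3 hint
      (hae.mono fun φ hφ => le_compressed_diag hlam hφ i B⁻¹)
    rw [integral_sub' (hint1.const_mul (2 * B⁻¹))
      ((integrable_finsetSum Finset.univ fun k _ => hint2 k).const_mul (B⁻¹ ^ 2)),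
      integral_const_mul, integral_const_mul, hE1, hE2] at hle
    refine le_trans (le_of_eq ?_) hle
    field_simp
    ring

/-- In the orthogonal-design setting with `E_φ[φ(φᵀΣφ)⁻¹φᵀ] = diag(1/ηᵢ)`, one
has `0 ≤ λᵢ/ηᵢ ≤ 1` for every `i` and `1 − λᵢ/ηᵢ ≤ wᵢ` where `wᵢ` is the
shrinkage factor of the improved compressed least squares bound. -/
theorem stmt10 (n p d : ℕ) (hd : 0 < d)
    (X : Matrix (Fin n) (Fin p) ℝ) (lam η : Fin p → ℝ)
    (hdiag : Xᵀ * X = Matrix.diagonal lam)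
    (hrank : (d : ℕ) ≤ X.rank)
    (μ : Measure (Fin p → Fin d → ℝ))
    (hμ : μ = Measure.pi fun _ : Fin p => Measure.pi fun _ : Fin d =>
      gaussianReal 0 ((d : ℝ≥0))⁻¹)
    (hη : ∀ i j, (∫ φ, (Matrix.of φ * ((Matrix.of φ)ᵀ * Xᵀ * X * Matrix.of φ)⁻¹
        * (Matrix.of φ)ᵀ) i j ∂μ) = if i = j then (η i)⁻¹ else 0)
    (s : ℝ) (hs : s = (Xᵀ * X).trace)
    (w : Fin p → ℝ)
    (hw : ∀ i, w i = ((1 + 1 / (d : ℝ)) * (lam i) ^ 2 + (1 + 2 / (d : ℝ)) * lam i * s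
        + s ^ 2 / (d : ℝ))
      / (((d : ℝ) + 2 + 1 / (d : ℝ)) * (lam i) ^ 2 + 2 * (1 + 1 / (d : ℝ)) * lam i * s
        + s ^ 2 / (d : ℝ))) :
    ∀ i, 0 ≤ lam i / η i ∧ lam i / η i ≤ 1 ∧ 1 - lam i / η i ≤ w i := by
  intro i
  have hdR : (0 : ℝ) < d := by exact_mod_cast hd
  have hlam (k : Fin p) : 0 ≤ lam k := by
    have h := congrFun (congrFun hdiag k) k
    rw [diagonal_apply_eq, mul_apply] at h
    rw [← h]
    exact Finset.sum_nonneg fun j _ => mul_self_nonneg (X j k)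
  have hcard : d ≤ Fintype.card {k // lam k ≠ 0} := by
    rwa [← rank_transpose_mul_self, hdiag, rank_diagonal] at hrank
  rw [hdiag, trace_diagonal] at hs
  have hspos : 0 < s := by
    obtain ⟨k, hk⟩ := Fintype.card_pos_iff.1 (hd.trans_le hcard)
    rw [hs]
    exact Finset.sum_pos' (fun k _ => hlam k) ⟨k, Finset.mem_univ k, (hlam k).lt_of_ne' hk⟩
  rcases (hlam i).eq_or_lt with h0 | hpos
  · rw [hw, ← h0]
    have : s ^ 2 / (d : ℝ) ≠ 0 := by positivity
    simp [this]
  · have hηi := hη i i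
    simp only [Matrix.mul_assoc _ Xᵀ X, hdiag, hμ, if_true] at hηi
    obtain ⟨hm0, hm1, hm2⟩ := integral_compressed_diag_bounds hd hlam hcard i hpos
    rw [hηi, ← hs] at hm2
    rw [hηi] at hm0 hm1
    rw [div_eq_mul_inv]
    refine ⟨mul_nonneg hpos.le hm0, hm1, ?_⟩
    have hwi : w i = 1 - lam i * ((1 + 1 / (d : ℝ)) * lam i + s / d)⁻¹ := by
      rw [hw]
      field_simp
      ring
    rw [hwi]
    gcongr
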